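/- Let Ω ⊂⊂ ℂⁿ be a pseudoconvex domain with smooth boundary. Then S(Ω) exists (i.e., S(Ω) < ∞) if and only if the closure of Ω has a strong Stein neighborhood basis. -/

import Mathlib

noncomputable section

open Complex Topology
open scoped ENNReal

/-- Wirtinger derivative `∂f/∂z_j`. -/
def dz {n : ℕ} (j : Fin n) (f : (Fin n → ℂ) → ℂ) (z : Fin n → ℂ) : ℂ :=
  (fderiv ℝ f z (Pi.single j 1) - Complex.I * fderiv ℝ f z (Pi.single j Complex.I)) / 2

/-- Wirtinger derivative `∂f/∂z̄_j`. -/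
def dzbar {n : ℕ} (j : Fin n) (f : (Fin n → ℂ) → ℂ) (z : Fin n → ℂ) : ℂ :=
  (fderiv ℝ f z (Pi.single j 1) + Complex.I * fderiv ℝ f z (Pi.single j Complex.I)) / 2

/-- Complexification of a real-valued function. -/
def cplx {n : ℕ} (ρ : (Fin n → ℂ) → ℝ) : (Fin n → ℂ) → ℂ := fun z => (ρ z : ℂ)

/-- The Levi form `L_ρ(X,Y)(z) = Σ_{j,k} ∂²ρ/∂z_j∂z̄_k (z) X_j conj(Y_k)`. -/
def levi {n : ℕ} (ρ : (Fin n → ℂ) → ℝ) (X Y : Fin n → ℂ) (z : Fin n → ℂ) : ℂ :=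
  ∑ j, ∑ k, dz j (fun w => dzbar k (cplx ρ) w) z * X j * (starRingEnd ℂ) (Y k)

/-- `Xf = Σ_j X_j ∂f/∂z_j` for a (1,0) vector `X`. -/
def dirDeriv {n : ℕ} (X : Fin n → ℂ) (f : (Fin n → ℂ) → ℂ) (z : Fin n → ℂ) : ℂ :=
  ∑ j, X j * dz j f z

/-- `X̄f = Σ_j conj(X_j) ∂f/∂z̄_j`. -/
def dirDerivBar {n : ℕ} (X : Fin n → ℂ) (f : (Fin n → ℂ) → ℂ) (z : Fin n → ℂ) : ℂ :=
  ∑ j, (starRingEnd ℂ) (X j) * dzbar j f z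

/-- Derivative of `f` along the (1,0) vector field `X`. -/
def fieldDeriv {n : ℕ} (X : (Fin n → ℂ) → (Fin n → ℂ)) (f : (Fin n → ℂ) → ℂ)
    (z : Fin n → ℂ) : ℂ :=
  dirDeriv (X z) f z

/-- Euclidean norm of the real gradient of `ρ`. -/
def gradNorm {n : ℕ} (ρ : (Fin n → ℂ) → ℝ) (z : Fin n → ℂ) : ℝ :=
  Real.sqrt (∑ j, ((fderiv ℝ ρ z (Pi.single j 1)) ^ 2 +
    (fderiv ℝ ρ z (Pi.single j Complex.I)) ^ 2))

/-- The complex normal field `N_ρ`. -/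
def nfield {n : ℕ} (ρ : (Fin n → ℂ) → ℝ) (z : Fin n → ℂ) : Fin n → ℂ := fun j =>
  ((Real.sqrt (∑ k, Complex.normSq (dz k (cplx ρ) z)) : ℝ) : ℂ)⁻¹ * dzbar j (cplx ρ) z

/-- Squared Euclidean norm of a vector in ℂⁿ. -/
def enormSq {n : ℕ} (X : Fin n → ℂ) : ℝ := ∑ j, Complex.normSq (X j)

/-- `f` is strictly plurisubharmonic on `S`. -/
def StrictPSHOn {n : ℕ} (f : (Fin n → ℂ) → ℝ) (S : Set (Fin n → ℂ)) : Prop :=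
  ∀ z ∈ S, ∀ X : Fin n → ℂ, X ≠ 0 → 0 < (levi f X X z).re

/-- `ρ` is a (global smooth) defining function of `Ω` on the neighborhood `V` of `cl Ω`. -/
structure IsDefFn {n : ℕ} (Ω V : Set (Fin n → ℂ)) (ρ : (Fin n → ℂ) → ℝ) : Prop where
  isOpen : IsOpen V
  subset : closure Ω ⊆ V
  smooth : ContDiffOn ℝ (⊤ : ℕ∞) ρ V
  eq : Ω = {z ∈ V | ρ z < 0}
  grad_ne : ∀ z ∈ frontier Ω, fderiv ℝ ρ z ≠ 0

/-- The Levi form of `ρ` is positive semidefinite on complex tangent vectors at `z`. -/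
def LeviPseudoconvexAt {n : ℕ} (ρ : (Fin n → ℂ) → ℝ) (z : Fin n → ℂ) : Prop :=
  ∀ X : Fin n → ℂ, dirDeriv X (cplx ρ) z = 0 → 0 ≤ (levi ρ X X z).re

/-- `Ω` is a (smoothly bounded, Levi) pseudoconvex domain. -/
def IsPseudoconvex {n : ℕ} (Ω : Set (Fin n → ℂ)) : Prop :=
  ∃ (V : Set (Fin n → ℂ)) (ρ : (Fin n → ℂ) → ℝ), IsDefFn Ω V ρ ∧
    ∀ p ∈ frontier Ω, LeviPseudoconvexAt ρ p

/-- The set of Steinness exponents of `ρ`. -/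
def steinExpSet {n : ℕ} (Ω : Set (Fin n → ℂ)) (ρ : (Fin n → ℂ) → ℝ) : Set ℝ :=
  {η : ℝ | 1 < η ∧ ∃ W : Set (Fin n → ℂ), IsOpen W ∧ frontier Ω ⊆ W ∧
    StrictPSHOn (fun z => ρ z ^ η) ((closure Ω)ᶜ ∩ W)}

/-- The Steinness exponent `η̃_ρ` of a defining function `ρ` (`∞` if none exists). -/
def steinExp {n : ℕ} (Ω : Set (Fin n → ℂ)) (ρ : (Fin n → ℂ) → ℝ) : ℝ≥0∞ :=
  sInf (ENNReal.ofReal '' steinExpSet Ω ρ)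

/-- The Steinness index `S(Ω)`. -/
def steinIndex {n : ℕ} (Ω : Set (Fin n → ℂ)) : ℝ≥0∞ :=
  ⨅ (V : Set (Fin n → ℂ)) (ρ : (Fin n → ℂ) → ℝ) (_ : IsDefFn Ω V ρ), steinExp Ω ρ

/-- The set of Diederich–Fornæss exponents of `ρ`. -/
def dfExpSet {n : ℕ} (Ω : Set (Fin n → ℂ)) (ρ : (Fin n → ℂ) → ℝ) : Set ℝ :=
  {η : ℝ | 0 < η ∧ η < 1 ∧ StrictPSHOn (fun z => -((-ρ z) ^ η)) Ω}

/-- The Diederich–Fornæss exponent of `ρ` (`0` if no exponent exists). -/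
def dfExp {n : ℕ} (Ω : Set (Fin n → ℂ)) (ρ : (Fin n → ℂ) → ℝ) : ℝ :=
  sSup (insert 0 (dfExpSet Ω ρ))

/-- The Diederich–Fornæss index `DF(Ω)`. -/
def dfIndex {n : ℕ} (Ω : Set (Fin n → ℂ)) : ℝ :=
  sSup {t : ℝ | ∃ V ρ, IsDefFn Ω V ρ ∧ t = dfExp Ω ρ}

/-- `L` is a smooth (1,0) tangent vector field for `ρ` on `A`. -/
def IsTangentField {n : ℕ} (ρ : (Fin n → ℂ) → ℝ) (L : (Fin n → ℂ) → (Fin n → ℂ))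
    (A : Set (Fin n → ℂ)) : Prop :=
  ContDiffOn ℝ (⊤ : ℕ∞) L A ∧ ∀ z ∈ A, dirDeriv (L z) (cplx ρ) z = 0

/-- The key differential inequality
`(1/(η₂−1))|L_ρ(L,N)|²/‖∇ρ‖² − (1/2)(N L_ρ(L,L))/‖∇ρ‖ ≤ 0` at `p`. -/
def keyIneqAt {n : ℕ} (ρ : (Fin n → ℂ) → ℝ) (L : (Fin n → ℂ) → (Fin n → ℂ)) (η₂ : ℝ)
    (p : Fin n → ℂ) : Prop :=
  1 / (η₂ - 1) * Complex.normSq (levi ρ (L p) (nfield ρ p) p) / (gradNorm ρ p) ^ 2 -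
    1 / 2 * (fieldDeriv (nfield ρ) (fun w => levi ρ (L w) (L w) w) p).re / gradNorm ρ p ≤ 0

/-- The strict version of the key differential inequality. -/
def strictKeyIneqAt {n : ℕ} (ρ : (Fin n → ℂ) → ℝ) (L : (Fin n → ℂ) → (Fin n → ℂ)) (η₂ : ℝ)
    (p : Fin n → ℂ) : Prop :=
  1 / (η₂ - 1) * Complex.normSq (levi ρ (L p) (nfield ρ p) p) / (gradNorm ρ p) ^ 2 -
    1 / 2 * (fieldDeriv (nfield ρ) (fun w => levi ρ (L w) (L w) w) p).re / gradNorm ρ p < 0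

/-- `cl Ω` has a strong Stein neighborhood basis. -/
def HasStrongSteinBasis {n : ℕ} (Ω : Set (Fin n → ℂ)) : Prop :=
  ∃ (V : Set (Fin n → ℂ)) (ρ : (Fin n → ℂ) → ℝ), IsDefFn Ω V ρ ∧ ∃ ε₀ : ℝ, 0 < ε₀ ∧
    (∀ z ∈ V, 0 ≤ ρ z → ρ z < ε₀ → fderiv ℝ ρ z ≠ 0) ∧
    ∀ ε : ℝ, 0 ≤ ε → ε < ε₀ → ∀ z ∈ V, ρ z = ε → LeviPseudoconvexAt ρ z

/-- Vanishing order at `0` of a holomorphic function `ℂ → ℂ` (`∞` if all derivatives vanish). -/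
def orderC (h : ℂ → ℂ) : ℕ∞ :=
  sInf ((fun k : ℕ => (k : ℕ∞)) '' {k : ℕ | iteratedDeriv k h 0 ≠ 0})

/-- Vanishing order at `0` of a real-valued function on `ℂ`. -/
def orderR (g : ℂ → ℝ) : ℕ∞ :=
  sInf ((fun k : ℕ => (k : ℕ∞)) '' {k : ℕ | iteratedFDeriv ℝ k g 0 ≠ 0})

/-- `ν(γ)`: minimal vanishing order at `0` of the components of `γ − p`. -/
def curveOrder {n : ℕ} (γ : ℂ → Fin n → ℂ) (p : Fin n → ℂ) : ℕ∞ :=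
  ⨅ j, orderC (fun t => γ t j - p j)

/-- `p` is a boundary point of finite D'Angelo 1-type (w.r.t. the defining function `ρ`). -/
def FiniteTypePt {n : ℕ} (ρ : (Fin n → ℂ) → ℝ) (p : Fin n → ℂ) : Prop :=
  ∃ M : ℕ, ∀ γ : ℂ → Fin n → ℂ, (∀ j, AnalyticAt ℂ (fun t => γ t j) 0) → γ 0 = p →
    ¬ (∀ᶠ t in nhds (0 : ℂ), γ t = p) →
    orderR (fun t => ρ (γ t)) ≤ (M : ℕ∞) * curveOrder γ p

variable {n : ℕ}

theorem fderiv_cplx {f : (Fin n → ℂ) → ℝ} {z : Fin n → ℂ} (hf : DifferentiableAt ℝ f z)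
    (v : Fin n → ℂ) : fderiv ℝ (cplx f) z v = (fderiv ℝ f z v : ℂ) := by
  have h : HasFDerivAt (cplx f) (Complex.ofRealCLM.comp (fderiv ℝ f z)) z :=
    Complex.ofRealCLM.hasFDerivAt.comp z hf.hasFDerivAt
  simp [h.fderiv]

theorem sum_single_re_im (X : Fin n → ℂ) :
    X = ∑ j, ((X j).re • (Pi.single j 1 : Fin n → ℂ) +
      (X j).im • (Pi.single j Complex.I : Fin n → ℂ)) := by
  ext i
  simp [Finset.sum_add_distrib, Finset.sum_apply, Pi.single_apply, Complex.re_add_im]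

theorem map_eq_sum_single {E : Type*} [NormedAddCommGroup E] [NormedSpace ℝ E]
    (G : (Fin n → ℂ) →L[ℝ] E) (X : Fin n → ℂ) :
    G X = ∑ j, ((X j).re • G (Pi.single j 1) + (X j).im • G (Pi.single j Complex.I)) := by
  conv_lhs => rw [sum_single_re_im X]
  simp only [map_sum, map_add, map_smul]

theorem dirDeriv_cplx {f : (Fin n → ℂ) → ℝ} {z : Fin n → ℂ} (hf : DifferentiableAt ℝ f z)
    (X : Fin n → ℂ) : dirDeriv X (cplx f) z =
      (fderiv ℝ f z X - Complex.I * fderiv ℝ f z (Complex.I • X)) / 2 := by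
  rw [map_eq_sum_single _ X, map_eq_sum_single _ (Complex.I • X)]
  simp only [dirDeriv, dz, fderiv_cplx hf, smul_eq_mul, Pi.smul_apply,
    Complex.ofReal_sum, Finset.mul_sum, ← Finset.sum_sub_distrib, Finset.sum_div]
  refine Finset.sum_congr rfl fun j _ => ?_
  apply Complex.ext <;> simp <;> ring

theorem dirDeriv_sub_smul (f : (Fin n → ℂ) → ℂ) (z X Y : Fin n → ℂ) (c : ℂ) :
    dirDeriv (X - c • Y) f z = dirDeriv X f z - c * dirDeriv Y f z := by
  simp [dirDeriv, sub_mul, Finset.sum_sub_distrib, Finset.mul_sum, mul_assoc]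

theorem normSq_dirDeriv_cplx {f : (Fin n → ℂ) → ℝ} {z : Fin n → ℂ} (hf : DifferentiableAt ℝ f z)
    (X : Fin n → ℂ) : Complex.normSq (dirDeriv X (cplx f) z) =
      ((fderiv ℝ f z X) ^ 2 + (fderiv ℝ f z (Complex.I • X)) ^ 2) / 4 := by
  rw [dirDeriv_cplx hf, Complex.normSq_div, Complex.normSq_apply]
  simp
  ring

theorem differentiableAt_fderiv_of_contDiffAt_two {f : (Fin n → ℂ) → ℝ} {z : Fin n → ℂ}
    (hf : ContDiffAt ℝ 2 f z) : DifferentiableAt ℝ (fderiv ℝ f) z :=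
  (hf.fderiv_right (m := 1) (by norm_num)).differentiableAt (by norm_num)

theorem dz_dzbar_cplx {f : (Fin n → ℂ) → ℝ} {z : Fin n → ℂ} (hf : ContDiffAt ℝ 2 f z)
    (j k : Fin n) : dz j (fun w => dzbar k (cplx f) w) z =
      ((fderiv ℝ (fderiv ℝ f) z (Pi.single j 1) (Pi.single k 1) : ℂ) +
        fderiv ℝ (fderiv ℝ f) z (Pi.single j Complex.I) (Pi.single k Complex.I) +
        Complex.I * (fderiv ℝ (fderiv ℝ f) z (Pi.single j 1) (Pi.single k Complex.I) -
          fderiv ℝ (fderiv ℝ f) z (Pi.single j Complex.I) (Pi.single k 1))) / 4 := by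
  have hd := differentiableAt_fderiv_of_contDiffAt_two hf
  have hev : (fun w => dzbar k (cplx f) w) =ᶠ[𝓝 z] fun w =>
      ((fderiv ℝ f w (Pi.single k 1) : ℂ) +
        Complex.I * (fderiv ℝ f w (Pi.single k Complex.I) : ℂ)) / 2 := by
    filter_upwards [hf.eventually (by simp)] with w hw
    rw [dzbar, fderiv_cplx (hw.differentiableAt (by norm_num)),
      fderiv_cplx (hw.differentiableAt (by norm_num))]
  have happ : ∀ v : Fin n → ℂ, HasFDerivAt (fun w => (fderiv ℝ f w v : ℂ))
      (Complex.ofRealCLM.comp ((ContinuousLinearMap.apply ℝ ℝ v).comp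
        (fderiv ℝ (fderiv ℝ f) z))) z := fun v =>
    Complex.ofRealCLM.hasFDerivAt.comp z
      ((ContinuousLinearMap.apply ℝ ℝ v).hasFDerivAt.comp z hd.hasFDerivAt)
  have hder := (((happ (Pi.single k 1)).add
    ((happ (Pi.single k Complex.I)).const_mul Complex.I)).mul_const (2⁻¹ : ℂ)).congr_of_eventuallyEq
      (hev.trans (Filter.Eventually.of_forall fun w => by simp [div_eq_mul_inv]))
  rw [dz, hder.fderiv]
  apply Complex.ext <;> simp <;> ring

theorem levi_re {f : (Fin n → ℂ) → ℝ} {z : Fin n → ℂ} (hf : ContDiffAt ℝ 2 f z)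
    (X : Fin n → ℂ) : (levi f X X z).re =
      (fderiv ℝ (fderiv ℝ f) z X X +
        fderiv ℝ (fderiv ℝ f) z (Complex.I • X) (Complex.I • X)) / 4 := by
  have expand : ∀ Y : Fin n → ℂ, fderiv ℝ (fderiv ℝ f) z Y Y = ∑ j, ∑ k,
      ((Y j).re * ((Y k).re * fderiv ℝ (fderiv ℝ f) z (Pi.single j 1) (Pi.single k 1) +
        (Y k).im * fderiv ℝ (fderiv ℝ f) z (Pi.single j 1) (Pi.single k Complex.I)) +
      (Y j).im * ((Y k).re * fderiv ℝ (fderiv ℝ f) z (Pi.single j Complex.I) (Pi.single k 1) +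
        (Y k).im *
          fderiv ℝ (fderiv ℝ f) z (Pi.single j Complex.I) (Pi.single k Complex.I))) := by
    intro Y
    rw [map_eq_sum_single (fderiv ℝ (fderiv ℝ f) z) Y, sum_apply]
    refine Finset.sum_congr rfl fun j _ => ?_
    rw [add_apply, smul_apply, smul_apply, map_eq_sum_single _ Y,
      map_eq_sum_single (fderiv ℝ (fderiv ℝ f) z (Pi.single j Complex.I)) Y, Finset.smul_sum,
      Finset.smul_sum, ← Finset.sum_add_distrib]
    simp only [smul_eq_mul]
  rw [expand X, expand (Complex.I • X), levi]
  simp only [Complex.re_sum, ← Finset.sum_add_distrib, Finset.sum_div]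
  refine Finset.sum_congr rfl fun j _ => Finset.sum_congr rfl fun k _ => ?_
  rw [dz_dzbar_cplx hf]
  simp
  ring

theorem dirDeriv_comp {u : (Fin n → ℂ) → ℝ} {z : Fin n → ℂ} {h : ℝ → ℝ} {a : ℝ}
    (hu : DifferentiableAt ℝ u z) (hh : HasDerivAt h a (u z)) (X : Fin n → ℂ) :
    dirDeriv X (cplx fun w => h (u w)) z = a * dirDeriv X (cplx u) z := by
  have hc : HasFDerivAt (fun w => h (u w)) (a • fderiv ℝ u z) z :=
    hh.comp_hasFDerivAt z hu.hasFDerivAt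
  rw [dirDeriv_cplx hu, dirDeriv_cplx hc.differentiableAt, hc.fderiv]
  simp
  ring

theorem dirDeriv_add {u v : (Fin n → ℂ) → ℝ} {z : Fin n → ℂ}
    (hu : DifferentiableAt ℝ u z) (hv : DifferentiableAt ℝ v z) (X : Fin n → ℂ) :
    dirDeriv X (cplx fun w => u w + v w) z =
      dirDeriv X (cplx u) z + dirDeriv X (cplx v) z := by
  rw [dirDeriv_cplx hu, dirDeriv_cplx hv, dirDeriv_cplx (hu.fun_add hv), fderiv_fun_add hu hv]
  simp
  ring

theorem levi_comp {u : (Fin n → ℂ) → ℝ} {z : Fin n → ℂ} {h h' : ℝ → ℝ} {b : ℝ}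
    (hu : ContDiffAt ℝ 2 u z) (hc : ContDiffAt ℝ 2 h (u z))
    (hh : ∀ᶠ y in 𝓝 (u z), HasDerivAt h (h' y) y) (hh' : HasDerivAt h' b (u z))
    (X : Fin n → ℂ) : (levi (fun w => h (u w)) X X z).re =
      h' (u z) * (levi u X X z).re + b * Complex.normSq (dirDeriv X (cplx u) z) := by
  have hud := hu.differentiableAt (by norm_num)
  have hev : fderiv ℝ (fun w => h (u w)) =ᶠ[𝓝 z] fun w => h' (u w) • fderiv ℝ u w := by
    filter_upwards [hu.eventually (by simp), hu.continuousAt.eventually hh] with w hw hw'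
    exact (hw'.comp_hasFDerivAt w (hw.differentiableAt (by norm_num)).hasFDerivAt).fderiv
  have hder := ((hh'.comp_hasFDerivAt z hud.hasFDerivAt).smul
    (differentiableAt_fderiv_of_contDiffAt_two hu).hasFDerivAt).congr_of_eventuallyEq hev
  have hcu : ContDiffAt ℝ 2 (fun w => h (u w)) z := hc.comp z hu
  rw [levi_re hcu, levi_re hu, normSq_dirDeriv_cplx hud, HasFDerivAt.fderiv hder]
  simp
  ring

theorem levi_add {u v : (Fin n → ℂ) → ℝ} {z : Fin n → ℂ}
    (hu : ContDiffAt ℝ 2 u z) (hv : ContDiffAt ℝ 2 v z) (X : Fin n → ℂ) :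
    (levi (fun w => u w + v w) X X z).re = (levi u X X z).re + (levi v X X z).re := by
  have hev : fderiv ℝ (fun w => u w + v w) =ᶠ[𝓝 z] fun w => fderiv ℝ u w + fderiv ℝ v w := by
    filter_upwards [hu.eventually (by simp), hv.eventually (by simp)] with w hw hw'
    exact fderiv_fun_add (hw.differentiableAt (by norm_num)) (hw'.differentiableAt (by norm_num))
  rw [levi_re (hu.add hv), levi_re hu, levi_re hv, hev.fderiv_eq,
    fderiv_fun_add (differentiableAt_fderiv_of_contDiffAt_two hu)
      (differentiableAt_fderiv_of_contDiffAt_two hv)]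
  simp
  ring

theorem levi_congr {u v : (Fin n → ℂ) → ℝ} {z : Fin n → ℂ} (hu : ContDiffAt ℝ 2 u z)
    (h : u =ᶠ[𝓝 z] v) (X : Fin n → ℂ) : (levi u X X z).re = (levi v X X z).re := by
  rw [levi_re hu, levi_re (hu.congr_of_eventuallyEq h.symm), (h.fderiv (𝕜 := ℝ)).fderiv_eq]

theorem enormSq_eq (z : Fin n → ℂ) : enormSq z = ∑ j, ((z j).re ^ 2 + (z j).im ^ 2) := by
  simp [enormSq, Complex.normSq_apply, sq]

theorem contDiff_enormSq {m : WithTop ℕ∞} :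
    ContDiff ℝ m (enormSq : (Fin n → ℂ) → ℝ) := by
  have h : (enormSq : (Fin n → ℂ) → ℝ) =
      fun z => ∑ j, ((Complex.reCLM (z j)) ^ 2 + (Complex.imCLM (z j)) ^ 2) := by
    ext z; simp [enormSq_eq]
  rw [h]
  exact ContDiff.sum fun j _ => by fun_prop

theorem hasFDerivAt_enormSq (z : Fin n → ℂ) : HasFDerivAt (enormSq : (Fin n → ℂ) → ℝ)
    (∑ j, ((2 * (z j).re) • Complex.reCLM.comp (ContinuousLinearMap.proj j) +
      (2 * (z j).im) • Complex.imCLM.comp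
        (ContinuousLinearMap.proj (R := ℝ) (φ := fun _ : Fin n => ℂ) j))) z := by
  have h : (enormSq : (Fin n → ℂ) → ℝ) =
      fun z => ∑ j, ((Complex.reCLM (z j)) ^ 2 + (Complex.imCLM (z j)) ^ 2) := by
    ext z; simp [enormSq_eq]
  rw [h]
  refine HasFDerivAt.fun_sum fun j _ => ?_
  have hp : HasFDerivAt (fun w : Fin n → ℂ => w j)
    (ContinuousLinearMap.proj (R := ℝ) (φ := fun _ : Fin n => ℂ) j) z := hasFDerivAt_apply j z
  have := ((Complex.reCLM.hasFDerivAt.comp z hp).pow 2).fun_add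
    ((Complex.imCLM.hasFDerivAt.comp z hp).pow 2)
  simpa using this

theorem fderiv_enormSq_apply (z v : Fin n → ℂ) : fderiv ℝ (enormSq : (Fin n → ℂ) → ℝ) z v =
    ∑ j, (2 * (z j).re * (v j).re + 2 * (z j).im * (v j).im) := by
  rw [(hasFDerivAt_enormSq z).fderiv, sum_apply]
  simp

theorem fderiv_fderiv_enormSq (z v : Fin n → ℂ) :
    fderiv ℝ (fderiv ℝ (enormSq : (Fin n → ℂ) → ℝ)) z v v = 2 * enormSq v := by
  have hd := differentiableAt_fderiv_of_contDiffAt_two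
    (contDiff_enormSq (n := n)).contDiffAt (z := z)
  have h1 : HasFDerivAt (fun w => fderiv ℝ enormSq w v) ((ContinuousLinearMap.apply ℝ ℝ v).comp
      (fderiv ℝ (fderiv ℝ enormSq) z)) z :=
    (ContinuousLinearMap.apply ℝ ℝ v).hasFDerivAt.comp z hd.hasFDerivAt
  have h2 : (fun w => fderiv ℝ enormSq w v) = fderiv ℝ enormSq v := by
    ext w
    simp only [fderiv_enormSq_apply]
    exact Finset.sum_congr rfl fun j _ => by ring
  rw [h2] at h1
  have h3 := congrArg (fun G => G v) (h1.unique (fderiv ℝ enormSq v).hasFDerivAt)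
  refine h3.trans ?_
  rw [fderiv_enormSq_apply, enormSq_eq, Finset.mul_sum]
  exact Finset.sum_congr rfl fun j _ => by ring

theorem levi_enormSq (z X : Fin n → ℂ) : (levi enormSq X X z).re = enormSq X := by
  rw [levi_re contDiff_enormSq.contDiffAt, fderiv_fderiv_enormSq, fderiv_fderiv_enormSq]
  have h : enormSq (Complex.I • X) = enormSq X := by simp [enormSq]
  rw [h]
  ring

theorem continuousAt_dirDeriv_cplx {f : (Fin n → ℂ) → ℝ} {p : Fin n → ℂ}
    (hf : ContDiffAt ℝ 2 f p) (X : Fin n → ℂ) :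
    ContinuousAt (fun z => dirDeriv X (cplx f) z) p := by
  have hc := (differentiableAt_fderiv_of_contDiffAt_two hf).continuousAt
  have h : ContinuousAt (fun z => ((fderiv ℝ f z X : ℂ) -
      Complex.I * fderiv ℝ f z (Complex.I • X)) / 2) p := by
    have happ : ∀ v : Fin n → ℂ, ContinuousAt (fun z => (fderiv ℝ f z v : ℂ)) p := fun v =>
      Complex.continuous_ofReal.continuousAt.comp (hc.clm_apply continuousAt_const)
    exact ((happ X).sub (continuousAt_const.mul (happ _))).div_const 2
  refine h.congr ?_
  filter_upwards [hf.eventually (by simp)] with z hz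
  exact (dirDeriv_cplx (hz.differentiableAt (by norm_num)) X).symm

theorem exists_dirDeriv_cplx_ne_zero {f : (Fin n → ℂ) → ℝ} {p : Fin n → ℂ}
    (hp : fderiv ℝ f p ≠ 0) : ∃ N, dirDeriv N (cplx f) p ≠ 0 := by
  have hd : DifferentiableAt ℝ f p := by
    by_contra h
    exact hp (fderiv_zero_of_not_differentiableAt h)
  obtain ⟨N, hN⟩ : ∃ N, fderiv ℝ f p N ≠ 0 := by
    by_contra! h
    exact hp (ContinuousLinearMap.ext h)
  refine ⟨N, fun h => hN ?_⟩
  rw [dirDeriv_cplx hd] at h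
  simpa using congrArg Complex.re h

/-- The component of `X` in the complex tangent space, along the transverse vector `N`. -/
theorem dirDeriv_tangential_part {f : (Fin n → ℂ) → ℂ} {z N : Fin n → ℂ}
    (hN : dirDeriv N f z ≠ 0) (X : Fin n → ℂ) :
    dirDeriv (X - (dirDeriv X f z / dirDeriv N f z) • N) f z = 0 := by
  rw [dirDeriv_sub_smul, div_mul_cancel₀ _ hN, sub_self]

theorem leviPseudoconvexAt_of_frequently {f : (Fin n → ℂ) → ℝ} {p : Fin n → ℂ}
    (hf : ContDiffAt ℝ 2 f p) (hp : fderiv ℝ f p ≠ 0)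
    (h : ∃ᶠ z in 𝓝 p, LeviPseudoconvexAt f z) : LeviPseudoconvexAt f p := by
  intro X hX
  obtain ⟨N, hN⟩ := exists_dirDeriv_cplx_ne_zero hp
  have hdN := continuousAt_dirDeriv_cplx hf N
  set T : (Fin n → ℂ) → Fin n → ℂ := fun z =>
    X - (dirDeriv X (cplx f) z / dirDeriv N (cplx f) z) • N with hT
  have hTc : ContinuousAt T p := continuousAt_const.sub
    (((continuousAt_dirDeriv_cplx hf X).div hdN hN).smul continuousAt_const)
  have hTp : T p = X := by simp [hT, hX]
  have hH : ContinuousAt (fderiv ℝ (fderiv ℝ f)) p :=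
    ((hf.fderiv_right (m := 1) (by norm_num)).fderiv_right (m := 0)
      (by norm_num)).continuousAt
  have hLc : ContinuousAt (fun z => (levi f (T z) (T z) z).re) p := by
    have hIT : ContinuousAt (fun z => Complex.I • T z) p := hTc.const_smul Complex.I
    refine ((((hH.clm_apply hTc).clm_apply hTc).add
      ((hH.clm_apply hIT).clm_apply hIT)).div_const 4).congr ?_
    filter_upwards [hf.eventually (by simp)] with z hz
    exact (levi_re hz (T z)).symm
  by_contra! hneg
  have hev := hLc.eventually_lt_const (u := 0) (by simpa only [hTp] using hneg)
  obtain ⟨z, hz, hz', hz''⟩ := (h.and_eventually (hev.and (hdN.eventually_ne hN))).exists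
  exact absurd (hz _ (dirDeriv_tangential_part hz'' X)) (not_le.2 hz')

theorem norm_dirDeriv_cplx_le {f : (Fin n → ℂ) → ℝ} {z : Fin n → ℂ}
    (hf : DifferentiableAt ℝ f z) (X : Fin n → ℂ) :
    ‖dirDeriv X (cplx f) z‖ ≤ ‖fderiv ℝ f z‖ * ‖X‖ := by
  have h1 := (fderiv ℝ f z).le_opNorm X
  have h2 := (fderiv ℝ f z).le_opNorm (Complex.I • X)
  rw [norm_smul, Complex.norm_I, one_mul] at h2
  rw [dirDeriv_cplx hf, norm_div]
  have h3 := norm_sub_le (fderiv ℝ f z X : ℂ) (Complex.I * fderiv ℝ f z (Complex.I • X))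
  rw [norm_mul, Complex.norm_I, one_mul, Complex.norm_real, Complex.norm_real] at h3
  rw [Complex.norm_ofNat, div_le_iff₀ two_pos]
  linarith

theorem neg_le_apply_self_sub_apply_self {E : Type*} [NormedAddCommGroup E] [NormedSpace ℝ E]
    (H : E →L[ℝ] E →L[ℝ] ℝ) (X Y : E) :
    -(‖H‖ * (2 * ‖X‖ * ‖Y‖ + ‖Y‖ ^ 2)) ≤ H X X - H (X - Y) (X - Y) := by
  have h1 := neg_le_of_abs_le (H.le_opNorm₂ X Y)
  have h2 := neg_le_of_abs_le (H.le_opNorm₂ Y X)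
  have h3 := le_of_abs_le (H.le_opNorm₂ Y Y)
  simp only [map_sub, sub_apply]
  nlinarith

/-- Locally, the Levi form on all vectors is controlled from below as soon as it is positive
semidefinite on complex tangent vectors. -/
theorem exists_levi_lower_bound {f : (Fin n → ℂ) → ℝ} {p : Fin n → ℂ}
    (hf : ContDiffAt ℝ 2 f p) (hp : fderiv ℝ f p ≠ 0) :
    ∃ C : ℝ, 0 ≤ C ∧ ∀ᶠ z in 𝓝 p, LeviPseudoconvexAt f z →
      ∀ X, -(C * ‖X‖ * ‖dirDeriv X (cplx f) z‖) ≤ (levi f X X z).re := by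
  obtain ⟨N, hN⟩ := exists_dirDeriv_cplx_ne_zero hp
  have hdN := continuousAt_dirDeriv_cplx hf N
  have hD := (differentiableAt_fderiv_of_contDiffAt_two hf).continuousAt
  have hHn : ContinuousAt (fun z => ‖fderiv ℝ (fderiv ℝ f) z‖) p :=
    ((hf.fderiv_right (m := 1) (by norm_num)).fderiv_right (m := 0)
      (by norm_num)).continuousAt.norm
  set c := ‖dirDeriv N (cplx f) p‖ / 2
  have hc : 0 < c := half_pos (norm_pos_iff.2 hN)
  set κ := ‖N‖ / c
  have hκ : 0 ≤ κ := by positivity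
  set B := ‖fderiv ℝ (fderiv ℝ f) p‖ + 1
  set G := ‖fderiv ℝ f p‖ + 1
  have hB : 0 ≤ B := by positivity
  have hG : 0 ≤ G := by positivity
  refine ⟨B / 2 * (2 * κ + κ ^ 2 * G), by positivity, ?_⟩
  filter_upwards [hf.eventually (by simp),
    hdN.norm.eventually_const_lt (half_lt_self (norm_pos_iff.2 hN)),
    hD.norm.eventually_lt_const (lt_add_one _),
    hHn.eventually_lt_const (lt_add_one _)]
    with z hz hzN hzD hzH hpsc X
  have hN' : dirDeriv N (cplx f) z ≠ 0 := norm_pos_iff.1 (hc.trans hzN)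
  set Y := (dirDeriv X (cplx f) z / dirDeriv N (cplx f) z) • N with hY
  have hT := hpsc _ (dirDeriv_tangential_part hN' X)
  rw [← hY, levi_re hz, smul_sub] at hT
  have hYle : ‖Y‖ ≤ κ * ‖dirDeriv X (cplx f) z‖ := by
    rw [hY, norm_smul, norm_div]
    calc _ ≤ ‖dirDeriv X (cplx f) z‖ / c * ‖N‖ := by gcongr
      _ = _ := by simp only [κ]; ring
  have hdX : ‖dirDeriv X (cplx f) z‖ ≤ G * ‖X‖ :=
    (norm_dirDeriv_cplx_le (hz.differentiableAt (by norm_num)) X).trans (by gcongr)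
  have h1 := neg_le_apply_self_sub_apply_self (fderiv ℝ (fderiv ℝ f) z) X Y
  have h2 := neg_le_apply_self_sub_apply_self (fderiv ℝ (fderiv ℝ f) z)
    (Complex.I • X) (Complex.I • Y)
  simp only [norm_smul, Complex.norm_I, one_mul] at h2
  have h3 : ‖fderiv ℝ (fderiv ℝ f) z‖ * (2 * ‖X‖ * ‖Y‖ + ‖Y‖ ^ 2) ≤
      B * ((2 * κ + κ ^ 2 * G) * ‖X‖ * ‖dirDeriv X (cplx f) z‖) := by
    refine mul_le_mul hzH.le ?_ (by positivity) hB
    have h4 : ‖Y‖ ^ 2 ≤ κ ^ 2 * (‖dirDeriv X (cplx f) z‖ * (G * ‖X‖)) :=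
      calc ‖Y‖ ^ 2 ≤ (κ * ‖dirDeriv X (cplx f) z‖) ^ 2 := by gcongr
        _ = κ ^ 2 * (‖dirDeriv X (cplx f) z‖ * ‖dirDeriv X (cplx f) z‖) := by ring
        _ ≤ _ := by gcongr
    have h5 : 2 * ‖X‖ * ‖Y‖ ≤ 2 * ‖X‖ * (κ * ‖dirDeriv X (cplx f) z‖) := by gcongr
    linarith
  rw [levi_re hz]
  linarith

theorem norm_le_sqrt_enormSq (X : Fin n → ℂ) : ‖X‖ ≤ Real.sqrt (enormSq X) := by
  refine (pi_norm_le_iff_of_nonneg (Real.sqrt_nonneg _)).2 fun j => Real.le_sqrt_of_sq_le ?_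
  rw [← Complex.normSq_eq_norm_sq]
  exact Finset.single_le_sum (f := fun j => Complex.normSq (X j))
    (fun i _ => Complex.normSq_nonneg _) (Finset.mem_univ j)

theorem perturbed_form_pos {C x s y β q η : ℝ} (hC : 0 ≤ C) (hx : 0 < x) (hs : 0 ≤ s)
    (hq : 0 < q) (hq' : q ≤ 1 / 8) (hη : 3 + C ^ 2 / q ≤ η) (hsy : s ≤ y + q * β) :
    0 < -(C * x * s) - s ^ 2 + q * ((C ^ 2 + 1) * x ^ 2 + β ^ 2) + η * y ^ 2 := by
  have h1 : C * x * s ≤ C * x * (y + q * β) := by gcongr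
  have h2 : s ^ 2 ≤ 2 * y ^ 2 + q * β ^ 2 / 4 := by
    have : s ^ 2 ≤ (y + q * β) ^ 2 := by gcongr
    have h3 : q * (q * β ^ 2) ≤ 1 / 8 * (q * β ^ 2) := by gcongr
    nlinarith [sq_nonneg (y - q * β)]
  have h4 : C * x * (q * β) ≤ q * (C ^ 2 * x ^ 2 + β ^ 2 / 4) := by
    nlinarith [mul_nonneg hq.le (sq_nonneg (C * x - β / 2))]
  have h5 : (3 + C ^ 2 / q) * y ^ 2 ≤ η * y ^ 2 := by gcongr
  have h6 : C * x * y ≤ q * x ^ 2 / 4 + C ^ 2 / q * y ^ 2 := by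
    have : q * x ^ 2 / 4 + C ^ 2 / q * y ^ 2 - C * x * y = (q * x / 2 - C * y) ^ 2 / q := by
      field_simp
      ring
    have : 0 ≤ (q * x / 2 - C * y) ^ 2 / q := by positivity
    linarith
  have h7 : 0 < q * x ^ 2 := by positivity
  nlinarith [sq_nonneg y, mul_nonneg hq.le (sq_nonneg β)]

/-- Strict plurisubharmonicity of `(ρ exp (δ exp (M |z|²))) ^ η` at a point where `ρ > 0` and the
Levi form of `ρ` is bounded below in terms of the normal component of the vector. -/
theorem levi_rpow_pos {ρ : (Fin n → ℂ) → ℝ} {z : Fin n → ℂ} {C δ η : ℝ}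
    (hρ : ContDiffAt ℝ 2 ρ z) (hpos : 0 < ρ z) (hC : 0 ≤ C)
    (hL : ∀ X, -(C * ‖X‖ * ‖dirDeriv X (cplx ρ) z‖) ≤ (levi ρ X X z).re)
    (hδ : 0 < δ) (hδ' : δ * Real.exp ((C ^ 2 + 1) * enormSq z) ≤ 1 / 8)
    (hη : 3 + C ^ 2 / δ ≤ η) {X : Fin n → ℂ} (hX : X ≠ 0) :
    0 < (levi (fun w => (ρ w * Real.exp (δ * Real.exp ((C ^ 2 + 1) * enormSq w))) ^ η)
      X X z).re := by
  set M := C ^ 2 + 1 with hM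
  have hM1 : 1 ≤ M := by nlinarith [sq_nonneg C]
  have hφc : ContDiff ℝ 2 fun y : ℝ => δ * Real.exp (M * y) := by fun_prop
  have hlog : ContDiffAt ℝ 2 (fun w => Real.log (ρ w)) z := hρ.log hpos.ne'
  have he : ContDiffAt ℝ 2 (enormSq : (Fin n → ℂ) → ℝ) z := contDiff_enormSq.contDiffAt
  have hφ : ContDiffAt ℝ 2 (fun w : Fin n → ℂ => δ * Real.exp (M * enormSq w)) z :=
    hφc.contDiffAt.comp z he
  have hu : ContDiffAt ℝ 2 (fun w => Real.log (ρ w) + δ * Real.exp (M * enormSq w)) z :=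
    hlog.add hφ
  have hexpc : ContDiff ℝ 2 fun y : ℝ => Real.exp (η * y) := by fun_prop
  have hexp : ContDiffAt ℝ 2
      (fun w => Real.exp (η * (Real.log (ρ w) + δ * Real.exp (M * enormSq w)))) z :=
    hexpc.contDiffAt.comp z hu
  have hev : (fun w => Real.exp (η * (Real.log (ρ w) + δ * Real.exp (M * enormSq w))))
      =ᶠ[𝓝 z] fun w => (ρ w * Real.exp (δ * Real.exp (M * enormSq w))) ^ η := by
    filter_upwards [hρ.continuousAt.eventually_const_lt hpos] with w hw
    rw [Real.rpow_def_of_pos (by positivity), Real.log_mul hw.ne' (Real.exp_ne_zero _),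
      Real.log_exp, mul_comm η]
  have dexp : ∀ a b y : ℝ, HasDerivAt (fun y => b * Real.exp (a * y))
      (b * a * Real.exp (a * y)) y := fun a b y => by
    have := (((hasDerivAt_id y).const_mul a).exp).const_mul b
    simp only [id, mul_one] at this
    exact this.congr_deriv (by ring)
  rw [← levi_congr hexp hev,
    levi_comp (h := fun y => Real.exp (η * y)) (h' := fun y => η * Real.exp (η * y)) hu
      hexpc.contDiffAt (.of_forall fun y => by simpa using dexp η 1 y) (dexp η η _) X,
    levi_add hlog hφ,
    levi_comp (h := Real.log) (h' := fun y => y⁻¹) hρ (Real.contDiffAt_log.2 hpos.ne')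
      ((eventually_ne_nhds hpos.ne').mono fun y hy => Real.hasDerivAt_log hy)
      (hasDerivAt_inv hpos.ne') X,
    levi_comp (h := fun y => δ * Real.exp (M * y)) (h' := fun y => δ * M * Real.exp (M * y)) he
      hφc.contDiffAt (.of_forall fun y => dexp M δ y) (dexp M (δ * M) _) X,
    levi_enormSq, dirDeriv_add (hlog.differentiableAt (by norm_num))
      (hφ.differentiableAt (by norm_num)),
    dirDeriv_comp (h := Real.log) (hρ.differentiableAt (by norm_num))
      (Real.hasDerivAt_log hpos.ne'),
    dirDeriv_comp (h := fun y => δ * Real.exp (M * y)) (he.differentiableAt (by norm_num))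
      (dexp M δ _)]
  simp only [Complex.normSq_eq_norm_sq]
  set d := dirDeriv X (cplx ρ) z
  set b := dirDeriv X (cplx enormSq) z
  set E := Real.exp (M * enormSq z) with hE
  set W := Real.exp (η * (Real.log (ρ z) + δ * E))
  set c : ℂ := ((ρ z)⁻¹ : ℝ) * d + (δ * M * E : ℝ) * b with hc
  have hE1 : 1 ≤ E := Real.one_le_exp (mul_nonneg (by linarith)
    (Finset.sum_nonneg fun i _ => Complex.normSq_nonneg _))
  have hx : 0 < ‖X‖ := norm_pos_iff.2 hX
  have hxx := norm_le_sqrt_enormSq X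
  have hsq : Real.sqrt (enormSq X) ^ 2 = enormSq X :=
    Real.sq_sqrt (Finset.sum_nonneg fun i _ => Complex.normSq_nonneg _)
  have hs : ‖d‖ / ρ z ≤ ‖c‖ + δ * E * (M * ‖b‖) := by
    have h1 : ((ρ z)⁻¹ : ℝ) * d = c - (δ * M * E : ℝ) * b := by rw [hc]; ring
    have h2 := norm_sub_le c ((δ * M * E : ℝ) * b)
    rw [← h1, norm_mul, norm_mul, Complex.norm_real, Complex.norm_real,
      Real.norm_of_nonneg (by positivity), Real.norm_of_nonneg (by positivity)] at h2
    calc ‖d‖ / ρ z = (ρ z)⁻¹ * ‖d‖ := by ring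
      _ ≤ _ := h2
      _ = _ := by ring
  have hηq : 3 + C ^ 2 / (δ * E) ≤ η := by
    refine le_trans ?_ hη
    gcongr
    nlinarith
  have hkey := perturbed_form_pos (y := ‖c‖) hC (hx.trans_le hxx) (by positivity) (by positivity)
    hδ' hηq hs
  have hLX : -(C * Real.sqrt (enormSq X) * (‖d‖ / ρ z)) ≤ (ρ z)⁻¹ * (levi ρ X X z).re := by
    have h1 : C * ‖X‖ * ‖d‖ ≤ C * Real.sqrt (enormSq X) * ‖d‖ := by gcongr
    calc -(C * Real.sqrt (enormSq X) * (‖d‖ / ρ z)) =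
        (ρ z)⁻¹ * -(C * Real.sqrt (enormSq X) * ‖d‖) := by ring
      _ ≤ _ := by gcongr; linarith [hL X]
  have hη0 : 0 < η := by
    have : 0 ≤ C ^ 2 / δ := by positivity
    linarith
  have hW : 0 < η * W := mul_pos hη0 (Real.exp_pos _)
  have hsum : 0 < (ρ z)⁻¹ * (levi ρ X X z).re + -(ρ z ^ 2)⁻¹ * ‖d‖ ^ 2 +
      (δ * M * E * enormSq X + δ * M * M * E * ‖b‖ ^ 2) + η * ‖c‖ ^ 2 := by
    rw [hsq, ← hM] at hkey
    have h1 : (‖d‖ / ρ z) ^ 2 = (ρ z ^ 2)⁻¹ * ‖d‖ ^ 2 := by field_simp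
    rw [h1] at hkey
    linarith
  calc 0 < η * W * ((ρ z)⁻¹ * (levi ρ X X z).re + -(ρ z ^ 2)⁻¹ * ‖d‖ ^ 2 +
      (δ * M * E * enormSq X + δ * M * M * E * ‖b‖ ^ 2) + η * ‖c‖ ^ 2) := mul_pos hW hsum
    _ = _ := by ring

theorem exists_eventually_nhdsSet_of_isCompact {α : Type*} [TopologicalSpace α] {K : Set α}
    (hK : IsCompact K) {P : ℝ → α → Prop} (hmono : ∀ a b z, a ≤ b → P a z → P b z)
    (h : ∀ p ∈ K, ∃ C, 0 ≤ C ∧ ∀ᶠ z in 𝓝 p, P C z) :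
    ∃ C, 0 ≤ C ∧ ∀ᶠ z in 𝓝ˢ K, P C z := by
  refine hK.induction_on (p := fun s => ∃ C, 0 ≤ C ∧ ∀ᶠ z in 𝓝ˢ s, P C z) ⟨0, le_rfl, by simp⟩
    (fun s t hst ⟨C, hC, ht⟩ => ⟨C, hC, ht.filter_mono (nhdsSet_mono hst)⟩) ?_ ?_
  · rintro s t ⟨C, hC, hs⟩ ⟨D, hD, ht⟩
    refine ⟨max C D, le_max_of_le_left hC, ?_⟩
    rw [nhdsSet_union, Filter.eventually_sup]
    exact ⟨hs.mono fun z => hmono _ _ z (le_max_left _ _),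
      ht.mono fun z => hmono _ _ z (le_max_right _ _)⟩
  · intro p hp
    obtain ⟨C, hC, hev⟩ := h p hp
    exact ⟨_, mem_nhdsWithin_of_mem_nhds hev.eventually_nhds, C, hC,
      eventually_nhdsSet_iff_forall.2 fun z hz => hz⟩

namespace IsDefFn

variable {Ω V : Set (Fin n → ℂ)} {ρ : (Fin n → ℂ) → ℝ} {z : Fin n → ℂ}

theorem contDiffAt (h : IsDefFn Ω V ρ) (hz : z ∈ V) : ContDiffAt ℝ 2 ρ z :=
  (h.smooth.contDiffAt (h.isOpen.mem_nhds hz)).of_le (WithTop.coe_le_coe.2 le_top)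

theorem mem_of_mem_frontier (h : IsDefFn Ω V ρ) (hz : z ∈ frontier Ω) : z ∈ V :=
  h.subset (frontier_subset_closure hz)

theorem nonneg (h : IsDefFn Ω V ρ) (hz : z ∈ V) (hz' : z ∉ Ω) : 0 ≤ ρ z := by
  by_contra! hlt
  exact hz' (h.eq ▸ ⟨hz, hlt⟩)

theorem nonpos (h : IsDefFn Ω V ρ) (hz : z ∈ closure Ω) : ρ z ≤ 0 := by
  have : (𝓝[Ω] z).NeBot := mem_closure_iff_nhdsWithin_neBot.1 hz
  refine le_of_tendsto ((h.contDiffAt (h.subset hz)).continuousAt.mono_left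
    (nhdsWithin_le_nhds (s := Ω))) ?_
  filter_upwards [self_mem_nhdsWithin] with w hw
  rw [h.eq] at hw
  exact hw.2.le

theorem eq_zero (h : IsDefFn Ω V ρ) (hΩ : IsOpen Ω) (hz : z ∈ frontier Ω) : ρ z = 0 :=
  le_antisymm (h.nonpos (frontier_subset_closure hz))
    (h.nonneg (h.mem_of_mem_frontier hz) (hΩ.frontier_eq ▸ hz).2)

theorem pos (h : IsDefFn Ω V ρ) (hz : z ∈ V) (hz' : z ∉ closure Ω) (hd : fderiv ℝ ρ z ≠ 0) :
    0 < ρ z := by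
  refine (h.nonneg hz fun h' => hz' (subset_closure h')).lt_of_ne fun h0 => hd ?_
  refine IsLocalMin.fderiv_eq_zero ?_
  filter_upwards [h.isOpen.mem_nhds hz, isClosed_closure.isOpen_compl.mem_nhds hz'] with w hw hw'
  rw [← h0]
  exact h.nonneg hw fun h' => hw' (subset_closure h')

theorem frequently_notMem_closure (h : IsDefFn Ω V ρ) (hΩ : IsOpen Ω) (hz : z ∈ frontier Ω) :
    ∃ᶠ w in 𝓝 z, w ∉ closure Ω := by
  intro hev
  refine h.grad_ne z hz (IsLocalMax.fderiv_eq_zero ?_)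
  filter_upwards [hev] with w hw
  rw [h.eq_zero hΩ hz]
  exact h.nonpos (not_not.1 hw)

theorem eventually_fderiv_ne_zero (h : IsDefFn Ω V ρ) (hz : z ∈ V) (hd : fderiv ℝ ρ z ≠ 0) :
    ∀ᶠ w in 𝓝 z, fderiv ℝ ρ w ≠ 0 :=
  (differentiableAt_fderiv_of_contDiffAt_two (h.contDiffAt hz)).continuousAt.eventually_ne hd

theorem mul_exp (h : IsDefFn Ω V ρ) (hΩ : IsOpen Ω) {φ : (Fin n → ℂ) → ℝ}
    (hφ : ContDiff ℝ (⊤ : ℕ∞) φ) : IsDefFn Ω V fun w => ρ w * Real.exp (φ w) where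
  isOpen := h.isOpen
  subset := h.subset
  smooth := h.smooth.mul hφ.exp.contDiffOn
  eq := by
    conv_lhs => rw [h.eq]
    ext w
    simp [mul_neg_iff, Real.exp_pos, (Real.exp_pos _).not_gt]
  grad_ne z hz h0 := by
    have hρ := (h.contDiffAt (h.mem_of_mem_frontier hz)).differentiableAt (by norm_num)
    have hd : DifferentiableAt ℝ (fun w => Real.exp (φ w)) z :=
      (hφ.differentiable (by norm_num)).exp z
    rw [fderiv_fun_mul hρ hd, h.eq_zero hΩ hz, zero_smul, zero_add,
      smul_eq_zero_iff_right (Real.exp_ne_zero _)] at h0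
    exact h.grad_ne z hz h0

end IsDefFn

/-- Where `ρ > 0`, strict plurisubharmonicity of `ρ ^ η` forces Levi pseudoconvexity of the level
set of `ρ`. -/
theorem leviPseudoconvexAt_of_levi_rpow_pos {ρ : (Fin n → ℂ) → ℝ} {z : Fin n → ℂ} {η : ℝ}
    (hρ : ContDiffAt ℝ 2 ρ z) (hpos : 0 < ρ z) (hη : 0 < η)
    (h : ∀ X : Fin n → ℂ, X ≠ 0 → 0 < (levi (fun w => ρ w ^ η) X X z).re) :
    LeviPseudoconvexAt ρ z := by
  intro X hX
  rcases eq_or_ne X 0 with rfl | hX0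
  · simp [levi]
  have hX' := h X hX0
  rw [levi_comp (h := fun y => y ^ η) (h' := fun y => η * y ^ (η - 1)) hρ
    (Real.contDiffAt_rpow_const_of_ne hpos.ne')
    ((eventually_ne_nhds hpos.ne').mono fun y hy => Real.hasDerivAt_rpow_const (Or.inl hy))
    ((Real.hasDerivAt_rpow_const (Or.inl hpos.ne')).const_mul η), hX] at hX'
  simp only [map_zero, mul_zero, add_zero] at hX'
  exact (pos_of_mul_pos_right hX' (by positivity)).le

theorem IsDefFn.hasStrongSteinBasis {Ω V : Set (Fin n → ℂ)} {ρ : (Fin n → ℂ) → ℝ} {η : ℝ}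
    (hρ : IsDefFn Ω V ρ) (hΩ : IsOpen Ω) (hη : η ∈ steinExpSet Ω ρ) : HasStrongSteinBasis Ω := by
  obtain ⟨hη1, W, hW, hΩW, hpsh⟩ := hη
  set U := {z | z ∈ V ∧ z ∈ W ∧ fderiv ℝ ρ z ≠ 0} with hU
  have hUo : IsOpen U := isOpen_iff_eventually.2 fun z hz =>
    (hρ.isOpen.eventually_mem hz.1).and ((hW.eventually_mem hz.2.1).and
      (hρ.eventually_fderiv_ne_zero hz.1 hz.2.2))
  have hfU : frontier Ω ⊆ U := fun z hz => ⟨hρ.mem_of_mem_frontier hz, hΩW hz, hρ.grad_ne z hz⟩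
  have hΩV : Ω ⊆ V := subset_closure.trans hρ.subset
  have hext : ∀ z ∈ U, z ∉ closure Ω → LeviPseudoconvexAt ρ z := fun z hz hz' =>
    leviPseudoconvexAt_of_levi_rpow_pos (hρ.contDiffAt hz.1) (hρ.pos hz.1 hz' hz.2.2)
      (zero_lt_one.trans hη1) (hpsh z ⟨hz', hz.2.1⟩)
  have hmem : ∀ z ∈ Ω ∪ U, 0 ≤ ρ z → z ∈ U ∧ z ∉ Ω := by
    intro z hz h0
    have hz' : z ∉ Ω := fun h => by
      rw [hρ.eq] at h
      exact h.2.not_ge h0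
    exact ⟨hz.resolve_left hz', hz'⟩
  refine ⟨Ω ∪ U, ρ, ⟨hΩ.union hUo, ?_, hρ.smooth.mono ?_, ?_, hρ.grad_ne⟩, 1, one_pos,
    fun z hz h0 _ => (hmem z hz h0).1.2.2, ?_⟩
  · rw [closure_eq_self_union_frontier]
    exact Set.union_subset_union_right _ hfU
  · exact Set.union_subset hΩV fun z hz => hz.1
  · refine Set.Subset.antisymm (fun z hz => ⟨Or.inl hz, ?_⟩) fun z hz => ?_
    · rw [hρ.eq] at hz
      exact hz.2
    · rw [hρ.eq]
      exact ⟨hz.1.elim (fun h => hΩV h) fun h => h.1, hz.2⟩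
  · rintro _ h0 - z hz rfl
    obtain ⟨hzU, hzΩ⟩ := hmem z hz h0
    by_cases hcl : z ∈ closure Ω
    · have hfr : z ∈ frontier Ω := hΩ.frontier_eq ▸ ⟨hcl, hzΩ⟩
      refine leviPseudoconvexAt_of_frequently (hρ.contDiffAt hzU.1) hzU.2.2 ?_
      exact ((hρ.frequently_notMem_closure hΩ hfr).and_eventually (hUo.eventually_mem hzU)).mono
        fun w hw => hext w hw.2 hw.1
    · exact hext z hzU hcl

theorem HasStrongSteinBasis.exists_steinExp_lt_top {Ω : Set (Fin n → ℂ)} (hΩ : IsOpen Ω)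
    (hbd : Bornology.IsBounded Ω) (h : HasStrongSteinBasis Ω) :
    ∃ V ρ, IsDefFn Ω V ρ ∧ (steinExpSet Ω ρ).Nonempty := by
  obtain ⟨V, ρ, hρ, ε₀, hε₀, -, hpsc⟩ := h
  have hK : IsCompact (frontier Ω) := hbd.isCompact_closure.of_isClosed_subset isClosed_frontier
    frontier_subset_closure
  have hecont : Continuous (enormSq : (Fin n → ℂ) → ℝ) :=
    (contDiff_enormSq (m := 0)).continuous
  obtain ⟨R, hR⟩ := (hK.image hecont).bddAbove
  obtain ⟨C, hC, hev⟩ := exists_eventually_nhdsSet_of_isCompact hK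
    (P := fun C z => z ∈ V ∧ fderiv ℝ ρ z ≠ 0 ∧ enormSq z < R + 1 ∧ (0 ≤ ρ z →
      ∀ X, -(C * ‖X‖ * ‖dirDeriv X (cplx ρ) z‖) ≤ (levi ρ X X z).re))
    (fun a b z hab ⟨h1, h2, h3, h4⟩ => ⟨h1, h2, h3, fun h0 X => le_trans (by gcongr) (h4 h0 X)⟩)
    (fun p hp => by
      have hpV := hρ.mem_of_mem_frontier hp
      obtain ⟨C, hC, hCev⟩ := exists_levi_lower_bound (hρ.contDiffAt hpV) (hρ.grad_ne p hp)
      refine ⟨C, hC, ?_⟩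
      filter_upwards [hρ.isOpen.mem_nhds hpV,
        hρ.eventually_fderiv_ne_zero hpV (hρ.grad_ne p hp),
        hecont.continuousAt.eventually_lt_const
          ((hR (Set.mem_image_of_mem _ hp)).trans_lt (lt_add_one R)),
        (hρ.contDiffAt hpV).continuousAt.eventually_lt_const
          ((hρ.eq_zero hΩ hp).trans_lt hε₀), hCev] with z h1 h2 h3 h4 h5
      exact ⟨h1, h2, h3, fun h0 => h5 (hpsc _ h0 h4 z h1 rfl)⟩)
  obtain ⟨W, hW, hKW, hWP⟩ := mem_nhdsSet_iff_exists.1 hev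
  set δ := Real.exp (-((C ^ 2 + 1) * (R + 1))) / 8
  have hδ : 0 < δ := by positivity
  refine ⟨V, _, hρ.mul_exp hΩ (φ := fun z => δ * Real.exp ((C ^ 2 + 1) * enormSq z)) ?_,
    3 + C ^ 2 / δ, ?_, W, hW, hKW, fun z hz X hX => ?_⟩
  · exact contDiff_const.mul (contDiff_const.mul contDiff_enormSq).exp
  · have : 0 ≤ C ^ 2 / δ := by positivity
    linarith
  · obtain ⟨h1, h2, h3, h4⟩ := hWP hz.2
    have hpos := hρ.pos h1 hz.1 h2
    refine levi_rpow_pos (hρ.contDiffAt h1) hpos hC (h4 hpos.le) hδ ?_ le_rfl hX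
    calc δ * Real.exp ((C ^ 2 + 1) * enormSq z) ≤ δ * Real.exp ((C ^ 2 + 1) * (R + 1)) := by
          gcongr
      _ = 1 / 8 := by
          simp only [δ]
          rw [div_mul_eq_mul_div, ← Real.exp_add, neg_add_cancel, Real.exp_zero]

/-- Theorem 4.1: `S(Ω)` exists (is finite) iff `cl Ω` has a strong Stein
neighborhood basis. -/
theorem steinIndex_exists_iff_strongSteinBasis {n : ℕ} (hn : 2 ≤ n)
    (Ω : Set (Fin n → ℂ)) (hΩ : IsOpen Ω) (hbd : Bornology.IsBounded Ω)
    (hpsc : IsPseudoconvex Ω) :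
    steinIndex Ω < ⊤ ↔ HasStrongSteinBasis Ω := by
  constructor
  · intro h
    simp only [steinIndex, iInf_lt_iff] at h
    obtain ⟨V, ρ, hρ, hlt⟩ := h
    obtain ⟨_, ⟨η, hη, rfl⟩, -⟩ := sInf_lt_iff.1 hlt
    exact hρ.hasStrongSteinBasis hΩ hη
  · intro h
    obtain ⟨V, ρ, hρ, η, hη⟩ := h.exists_steinExp_lt_top hΩ hbd
    simp only [steinIndex, iInf_lt_iff]
    exact ⟨V, ρ, hρ, sInf_lt_iff.2 ⟨_, Set.mem_image_of_mem _ hη, ENNReal.ofReal_lt_top⟩⟩
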